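/- arXiv:1402.5789 — 6 statements merged into one kernel-verified Lean document; each statement's English description precedes it below -/
import Mathlib

section
/- Let n ≥ 2 be an integer, let p be a prime dividing n, let e be the exponent of p in n, and let j ∈ ℕ. Then the function u_{p,j} : ℤ/nℤ → ℤ/nℤ is a polynomial function; in fact the polynomial (n/p^e)·X^j·(1 − X^{φ(n)}) ∈ (ℤ/nℤ)[X] evaluates to u_{p,j}. -/
/-- A function `f : ℤ/nℤ → ℤ/nℤ` is a polynomial function if some polynomial
over `ℤ/nℤ` evaluates to it. -/
def IsPolyFun (n : ℕ) (f : ZMod n → ZMod n) : Prop :=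
  ∃ g : Polynomial (ZMod n), ∀ a : ZMod n, g.eval a = f a

/-- The function `u_{p,j} : ℤ/nℤ → ℤ/nℤ`, equal to `(n/p^e)·a^j` (with `e` the
exponent of `p` in `n`, and `n/p^e` taken modulo `n`) when `p` divides the least
nonnegative residue of `a`, and `0` otherwise. -/
def upj (n p j : ℕ) : ZMod n → ZMod n :=
  fun a => if p ∣ a.val then ((n / p ^ n.factorization p : ℕ) : ZMod n) * a ^ j else 0

theorem ordCompl_mul_eq_zero (n p : ℕ) (x : ℤ)
    (h : ((p ^ n.factorization p : ℕ) : ℤ) ∣ x) :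
    ((n / p ^ n.factorization p : ℕ) : ZMod n) * (x : ZMod n) = 0 := by
  obtain ⟨y, rfl⟩ := h
  have h1 : ((p ^ n.factorization p * (n / p ^ n.factorization p) : ℕ) : ZMod n) = 0 := by
    rw [Nat.ordProj_mul_ordCompl_eq_self]
    exact ZMod.natCast_self n
  rw [Nat.cast_mul] at h1
  rw [Int.cast_mul, Int.cast_natCast]
  linear_combination (y : ZMod n) * h1

theorem factorization_le_totient (n p : ℕ) (hn : n ≠ 0) (hp : p.Prime) (hpn : p ∣ n) :
    n.factorization p ≤ n.totient := by
  have he : 0 < n.factorization p := hp.factorization_pos_of_dvd hn hpn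
  have h1 : (p ^ n.factorization p).totient ∣ n.totient :=
    Nat.totient_dvd_of_dvd (Nat.ordProj_dvd n p)
  have h2 : (p ^ n.factorization p).totient ≤ n.totient :=
    Nat.le_of_dvd (Nat.totient_pos.2 (Nat.pos_of_ne_zero hn)) h1
  rw [Nat.totient_prime_pow hp he] at h2
  have h3 : n.factorization p - 1 < p ^ (n.factorization p - 1) := Nat.lt_pow_self hp.one_lt
  have h4 : 1 ≤ p - 1 := by have := hp.two_le; omega
  nlinarith [Nat.le_mul_of_pos_right (p ^ (n.factorization p - 1)) h4, Nat.sub_add_cancel he]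

theorem upj_isPolyFun (n : ℕ) (hn : 2 ≤ n) (p : ℕ) (hp : p.Prime) (hpn : p ∣ n)
    (j : ℕ) :
    (∀ a : ZMod n,
      (Polynomial.C ((n / p ^ n.factorization p : ℕ) : ZMod n) *
        Polynomial.X ^ j * (1 - Polynomial.X ^ n.totient)).eval a = upj n p j a) ∧
    IsPolyFun n (upj n p j) := by
  have key : ∀ a : ZMod n,
      (Polynomial.C ((n / p ^ n.factorization p : ℕ) : ZMod n) *
        Polynomial.X ^ j * (1 - Polynomial.X ^ n.totient)).eval a = upj n p j a := by
    intro a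
    have hn0 : n ≠ 0 := by omega
    haveI : NeZero n := ⟨hn0⟩
    have ha : ((a.val : ℕ) : ZMod n) = a := ZMod.natCast_zmod_val a
    simp only [Polynomial.eval_mul, Polynomial.eval_C, Polynomial.eval_pow, Polynomial.eval_X,
      Polynomial.eval_sub, Polynomial.eval_one, upj]
    split_ifs with h
    · have h1 : p ^ n.factorization p ∣ a.val ^ n.totient :=
        (pow_dvd_pow p (factorization_le_totient n p hn0 hp hpn)).trans (pow_dvd_pow_of_dvd h _)
      have h2 := ordCompl_mul_eq_zero n p ((a.val ^ n.totient : ℕ) : ℤ) (by exact_mod_cast h1)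
      rw [Int.cast_natCast, Nat.cast_pow, ha] at h2
      linear_combination (-a ^ j) * h2
    · have hc : Nat.Coprime a.val (p ^ n.factorization p) :=
        Nat.Coprime.pow_right _ ((Nat.Prime.coprime_iff_not_dvd hp).2 h).symm
      have h1 : a.val ^ n.totient ≡ 1 [MOD p ^ n.factorization p] := by
        obtain ⟨k, hk⟩ := Nat.totient_dvd_of_dvd (Nat.ordProj_dvd n p)
        rw [hk, pow_mul]
        simpa using (Nat.ModEq.pow_totient hc).pow k
      have h2 := ordCompl_mul_eq_zero n p _ (Nat.modEq_iff_dvd.1 h1)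
      push_cast at h2
      rw [ha] at h2
      linear_combination a ^ j * h2
  exact ⟨key, _, key⟩
end

section
/- Let n ≥ 2 be an integer, let p be a prime dividing n with e the exponent of p in n, let j₁, j₂ ∈ ℕ, and let k₁, k₂ ∈ ℕ with k₁ ≢ k₂ (mod p). Then the pointwise product of the shifted functions u_{p,j₁}^{<k₁>} and u_{p,j₂}^{<k₂>} is the zero function on ℤ/nℤ. -/
theorem upj_shift_mul_shift_eq_zero (n : ℕ) (hn : 2 ≤ n) (p : ℕ) (hp : p.Prime)
    (hpn : p ∣ n) (j₁ j₂ k₁ k₂ : ℕ) (hk : ¬ k₁ ≡ k₂ [MOD p]) :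
    ∀ a : ZMod n, upj n p j₁ (a - (k₁ : ZMod n)) * upj n p j₂ (a - (k₂ : ZMod n)) = 0 := by
  intro a
  haveI : NeZero n := ⟨by omega⟩
  have key : ∀ b : ZMod n, p ∣ b.val → ZMod.castHom hpn (ZMod p) b = 0 := by
    intro b hb
    rw [← ZMod.natCast_zmod_val b, map_natCast]
    exact (ZMod.natCast_eq_zero_iff _ _).2 hb
  unfold upj
  split_ifs with h₁ h₂
  · exfalso
    apply hk
    have e₁ := key _ h₁
    have e₂ := key _ h₂
    rw [map_sub, map_natCast, sub_eq_zero] at e₁ e₂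
    exact (ZMod.natCast_eq_natCast_iff _ _ _).1 (e₁.symm.trans e₂)
  all_goals simp
end

section
/- Let n ≥ 2 be an integer. Then the constant function 1 on ℤ/nℤ belongs to the ℤ/nℤ-submodule of functions ℤ/nℤ → ℤ/nℤ spanned by the set of shifted functions { u_{p,0}^{<k>} : p a prime dividing n, 0 ≤ k < p }. -/
theorem upj_sum_shifts (n p : ℕ) (hn : 2 ≤ n) (hp : p.Prime) (hpn : p ∣ n) (a : ZMod n) :
    ∑ k ∈ Finset.range p, upj n p 0 (a - (k : ZMod n)) =
      ((n / p ^ n.factorization p : ℕ) : ZMod n) := by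
  haveI : NeZero n := ⟨by omega⟩
  haveI : NeZero p := ⟨hp.ne_zero⟩
  have key : ∀ k ∈ Finset.range p, upj n p 0 (a - (k : ZMod n)) =
      if k = a.val % p then ((n / p ^ n.factorization p : ℕ) : ZMod n) else 0 := by
    intro k hk
    have hk' := Finset.mem_range.mp hk
    have h : p ∣ (a - (k : ZMod n)).val ↔ k = a.val % p := by
      have h1 : (((a - (k : ZMod n)).val : ℕ) : ZMod p) = (a.val : ZMod p) - (k : ZMod p) := by
        have h2 := map_sub (ZMod.castHom hpn (ZMod p)) a (k : ZMod n)
        rw [map_natCast] at h2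
        simpa [ZMod.castHom_apply, ZMod.natCast_val] using h2
      rw [← ZMod.natCast_eq_zero_iff, h1, sub_eq_zero, ZMod.natCast_eq_natCast_iff']
      rw [Nat.mod_eq_of_lt hk', eq_comm]
    simp only [upj, h, pow_zero, mul_one]
  rw [Finset.sum_congr rfl key, Finset.sum_ite_eq' , if_pos]
  exact Finset.mem_range.mpr (Nat.mod_lt _ hp.pos)

theorem one_mem_span_upj_shifts (n : ℕ) (hn : 2 ≤ n) :
    (fun _ : ZMod n => (1 : ZMod n)) ∈ Submodule.span (ZMod n)
      {f : ZMod n → ZMod n | ∃ p k : ℕ, p.Prime ∧ p ∣ n ∧ k < p ∧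
        f = fun a => upj n p 0 (a - (k : ZMod n))} := by
  set S := Submodule.span (ZMod n)
      {f : ZMod n → ZMod n | ∃ p k : ℕ, p.Prime ∧ p ∣ n ∧ k < p ∧
        f = fun a => upj n p 0 (a - (k : ZMod n))} with hS
  let L : ZMod n →ₗ[ZMod n] (ZMod n → ZMod n) := LinearMap.pi (fun _ => LinearMap.id)
  let I : Ideal (ZMod n) := S.comap L
  let J : Ideal ℤ := I.comap (Int.castRingHom (ZMod n))
  have hJn : (n : ℤ) ∈ J := by
    change Int.castRingHom (ZMod n) n ∈ I
    simp
  have hJ : ∀ p : ℕ, p.Prime → p ∣ n → ((n / p ^ n.factorization p : ℕ) : ℤ) ∈ J := by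
    intro p hp hpn
    have h : L (Int.castRingHom (ZMod n) ((n / p ^ n.factorization p : ℕ) : ℤ)) =
        ∑ k ∈ Finset.range p, (fun a => upj n p 0 (a - (k : ZMod n))) := by
      funext a
      rw [Finset.sum_apply, upj_sum_shifts n p hn hp hpn a, map_natCast]
      rfl
    change L (Int.castRingHom (ZMod n) ((n / p ^ n.factorization p : ℕ) : ℤ)) ∈ S
    rw [h]
    exact Submodule.sum_mem _ fun k hk =>
      Submodule.subset_span ⟨p, k, hp, hpn, Finset.mem_range.mp hk, rfl⟩
  have hone : (1 : ℤ) ∈ J := by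
    rw [Submodule.IsPrincipal.mem_iff_generator_dvd]
    rw [Submodule.IsPrincipal.mem_iff_generator_dvd] at hJn
    rw [← isUnit_iff_dvd_one, Int.isUnit_iff_natAbs_eq]
    by_contra hne
    obtain ⟨q, hq, hqd⟩ := Nat.exists_prime_and_dvd hne
    have hqn : q ∣ n := hqd.trans (Int.natAbs_dvd_natAbs.mpr hJn)
    have h1 := hJ q hq hqn
    rw [Submodule.IsPrincipal.mem_iff_generator_dvd] at h1
    exact Nat.not_dvd_ordCompl hq (by omega) (hqd.trans (Int.natAbs_dvd_natAbs.mpr h1))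
  have h2 : L (Int.castRingHom (ZMod n) 1) ∈ S := hone
  rw [map_one] at h2
  exact h2
end

section
/- Let n ≥ 2 be an integer. Then the identity function a ↦ a on ℤ/nℤ belongs to the ℤ/nℤ-submodule of functions ℤ/nℤ → ℤ/nℤ spanned by the set { u_{p,j}^{<k>} : p a prime dividing n, 0 ≤ j < e_p, 0 ≤ k < p }, where e_p is the exponent of p in n. -/
theorem upj_dvd_iff (n p k : ℕ) [NeZero n] (hk : k < p) (hpn : p ∣ n) (a : ZMod n) :
    p ∣ (a - (k : ZMod n)).val ↔ k = a.val % p := by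
  have h1 : (((a - (k : ZMod n)).val : ℕ) : ZMod p) = (a.val : ZMod p) - (k : ZMod p) := by
    rw [ZMod.natCast_val, ZMod.natCast_val, ZMod.cast_sub hpn, ZMod.cast_natCast hpn]
  rw [← ZMod.natCast_eq_zero_iff, h1, sub_eq_zero, ZMod.natCast_eq_natCast_iff', Nat.mod_eq_of_lt hk]
  exact eq_comm

theorem id_mem_span_upj_shifts (n : ℕ) (hn : 2 ≤ n) :
    (fun a : ZMod n => a) ∈ Submodule.span (ZMod n)
      {f : ZMod n → ZMod n | ∃ p j k : ℕ, p.Prime ∧ p ∣ n ∧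
        j < n.factorization p ∧ k < p ∧
        f = fun a => upj n p j (a - (k : ZMod n))} := by
  have hn0 : n ≠ 0 := by omega
  haveI : NeZero n := ⟨hn0⟩
  set S := Submodule.span (ZMod n)
      {f : ZMod n → ZMod n | ∃ p j k : ℕ, p.Prime ∧ p ∣ n ∧
        j < n.factorization p ∧ k < p ∧
        f = fun a => upj n p j (a - (k : ZMod n))} with hS
  have key : ∀ p : ℕ, p.Prime → p ∣ n →
      ((n / p ^ n.factorization p : ℕ) : ZMod n) • (fun a : ZMod n => a) ∈ S := by
    intro p hp hpn
    have he : 0 < n.factorization p := hp.factorization_pos_of_dvd hn0 hpn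
    have h0 : ∀ k < p, (fun a => upj n p 0 (a - (k : ZMod n))) ∈ S := fun k hk =>
      Submodule.subset_span ⟨p, 0, k, hp, hpn, he, hk, rfl⟩
    have h1 : ∀ k < p, (fun a => upj n p 1 (a - (k : ZMod n))) ∈ S := by
      intro k hk
      by_cases h : 1 < n.factorization p
      · exact Submodule.subset_span ⟨p, 1, k, hp, hpn, h, hk, rfl⟩
      · have e1 : n.factorization p = 1 := by omega
        convert S.zero_mem using 1
        funext a
        simp only [upj, e1, pow_one, Pi.zero_apply]
        split_ifs with hd
        · obtain ⟨c, hc⟩ := hd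
          rw [← ZMod.natCast_zmod_val (a - (k : ZMod n)), hc, ← Nat.cast_mul, ← mul_assoc,
            Nat.div_mul_cancel hpn]
          simp
        · rfl
    have hsum : ((n / p ^ n.factorization p : ℕ) : ZMod n) • (fun a : ZMod n => a) =
        ∑ k ∈ Finset.range p, ((fun a => upj n p 1 (a - (k : ZMod n))) +
          (k : ZMod n) • (fun a => upj n p 0 (a - (k : ZMod n)))) := by
      funext a
      rw [Finset.sum_apply, Finset.sum_eq_single (a.val % p)]
      · have := (upj_dvd_iff n p (a.val % p) (Nat.mod_lt _ hp.pos) hpn a).2 rfl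
        simp only [upj, Pi.add_apply, Pi.smul_apply, smul_eq_mul, if_pos this]
        ring
      · intro k hk hne
        have := mt (upj_dvd_iff n p k (Finset.mem_range.1 hk) hpn a).1 hne
        simp only [upj, Pi.add_apply, Pi.smul_apply, smul_eq_mul, if_neg this]
        simp
      · intro h
        exact absurd (Finset.mem_range.2 (Nat.mod_lt _ hp.pos)) h
    rw [hsum]
    refine S.sum_mem fun k hk => S.add_mem (h1 k (Finset.mem_range.1 hk))
      (S.smul_mem _ (h0 k (Finset.mem_range.1 hk)))
  let I : Ideal (ZMod n) := S.comap (LinearMap.toSpanSingleton (ZMod n) _ (fun a : ZMod n => a))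
  have hI : ∀ c : ZMod n, c ∈ I ↔ c • (fun a : ZMod n => a) ∈ S := fun c => Iff.rfl
  let J : Ideal ℤ := I.comap (Int.castRingHom (ZMod n))
  have hJ : ∀ z : ℤ, z ∈ J ↔ (z : ZMod n) ∈ I := fun c => Iff.rfl
  obtain ⟨g, hg⟩ := (IsPrincipalIdealRing.principal J).principal
  have hdvd : ∀ z : ℤ, z ∈ J ↔ g ∣ z := fun z => by
    rw [hg]; exact Ideal.mem_span_singleton
  have hgn : g ∣ (n : ℤ) := by
    rw [← hdvd, hJ]; simp
  have hg1 : g.natAbs = 1 := by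
    by_contra hne
    obtain ⟨q, hq, hqg⟩ := Nat.exists_prime_and_dvd hne
    have hqg' : (q : ℤ) ∣ g := Int.natCast_dvd.2 hqg
    have hqn : q ∣ n := by exact_mod_cast hqg'.trans hgn
    have h2 : g ∣ ((n / q ^ n.factorization q : ℕ) : ℤ) := by
      rw [← hdvd, hJ, hI, Int.cast_natCast]
      exact key q hq hqn
    exact Nat.not_dvd_ordCompl hq hn0 (by exact_mod_cast hqg'.trans h2)
  have h1 : (1 : ℤ) ∈ J := by
    rw [hdvd]
    exact (Int.isUnit_iff_natAbs_eq.2 hg1).dvd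
  rw [hJ, hI] at h1
  simpa using h1
end

section
/- Let n ≥ 2 be an integer. A function f : ℤ/nℤ → ℤ/nℤ is a polynomial function if and only if f belongs to the ℤ/nℤ-submodule of functions ℤ/nℤ → ℤ/nℤ spanned by the set { u_{p,j}^{<k>} : p a prime dividing n, 0 ≤ j < e_p, 0 ≤ k < p }, where e_p is the exponent of p in n. Equivalently, this set generates the ℤ/nℤ-module of polynomial functions from ℤ/nℤ to itself. -/
lemma dvd_val_iff' {n p : ℕ} [NeZero n] (hp : p ∣ n) (x : ZMod n) :
    p ∣ x.val ↔ (p : ZMod n) ∣ x := by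
  constructor
  · rintro ⟨c, hc⟩
    refine ⟨(c : ZMod n), ?_⟩
    rw [← ZMod.natCast_zmod_val x, hc]; push_cast; rfl
  · rintro ⟨y, rfl⟩
    rw [ZMod.val_mul, Nat.dvd_mod_iff hp, ZMod.val_natCast]
    exact Dvd.dvd.mul_right ((Nat.dvd_mod_iff hp).2 dvd_rfl) _

lemma N_mul_pow {n p : ℕ} {i : ℕ} (hi : n.factorization p ≤ i)
    {x : ZMod n} (hx : (p : ZMod n) ∣ x) :
    ((n / p ^ n.factorization p : ℕ) : ZMod n) * x ^ i = 0 := by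
  obtain ⟨y, rfl⟩ := hx
  obtain ⟨d, rfl⟩ := Nat.exists_eq_add_of_le hi
  have h : ((n / p ^ n.factorization p : ℕ) : ZMod n) * (p : ZMod n) ^ n.factorization p = 0 := by
    have : (n / p ^ n.factorization p) * p ^ n.factorization p = n :=
      Nat.div_mul_cancel (Nat.ordProj_dvd n p)
    have h2 := congrArg (Nat.cast : ℕ → ZMod n) this
    push_cast at h2
    simpa using h2
  rw [mul_pow, pow_add]
  linear_combination ((p : ZMod n) ^ d * y ^ (n.factorization p + d)) * h

lemma N_mul_totient {n p : ℕ} [NeZero n] (hp : p.Prime)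
    {x : ZMod n} (hx : ¬ p ∣ x.val) (c : ℕ) :
    ((n / p ^ n.factorization p : ℕ) : ZMod n) *
      (1 - x ^ ((p ^ n.factorization p).totient * c)) = 0 := by
  have hco : Nat.Coprime x.val (p ^ n.factorization p) :=
    Nat.Coprime.pow_right _ ((Nat.Prime.coprime_iff_not_dvd hp).2 hx).symm
  have h1 := (Nat.ModEq.pow_totient hco).pow c
  rw [← pow_mul, one_pow] at h1
  have h2 := Nat.ModEq.mul_left' (n / p ^ n.factorization p) h1
  rw [Nat.div_mul_cancel (Nat.ordProj_dvd n p)] at h2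
  have h3 := (ZMod.natCast_eq_natCast_iff _ _ _).2 h2
  push_cast [ZMod.natCast_zmod_val] at h3
  linear_combination -h3

lemma upj_eq {n p : ℕ} [NeZero n] (hp : p.Prime) (hpn : p ∣ n) (j : ℕ) (x : ZMod n) :
    upj n p j x = ((n / p ^ n.factorization p : ℕ) : ZMod n) *
      ((1 - x ^ ((p ^ n.factorization p).totient * n.factorization p)) * x ^ j) := by
  unfold upj
  split_ifs with h
  · have := N_mul_pow (n := n) (p := p)
      (i := (p ^ n.factorization p).totient * n.factorization p)
      (Nat.le_mul_of_pos_left _ (Nat.totient_pos.2 (pow_pos hp.pos _)))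
      ((dvd_val_iff' hpn x).1 h)
    linear_combination x ^ j * this
  · have := N_mul_totient (n := n) hp h (n.factorization p)
    linear_combination -(x ^ j) * this

lemma exists_sum_N (n : ℕ) (hn : 2 ≤ n) : ∃ c : ℕ → ZMod n,
    ∑ p ∈ n.primeFactors, c p * ((n / p ^ n.factorization p : ℕ) : ZMod n) = 1 := by
  have hne : n.primeFactors.Nonempty := Nat.nonempty_primeFactors.2 hn
  have h := (exists_sum_eq_one_iff_pairwise_coprime (t := n.primeFactors)
    (s := fun p : ℕ => ((p ^ n.factorization p : ℕ) : ℤ)) hne).2 (by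
      rintro ⟨p, hp⟩ ⟨q, hq⟩ hpq
      have hpq' : p ≠ q := fun h => hpq (Subtype.ext h)
      exact Nat.isCoprime_iff_coprime.2 (Nat.Coprime.pow _ _
        ((Nat.coprime_primes (Nat.prime_of_mem_primeFactors hp)
          (Nat.prime_of_mem_primeFactors hq)).2 hpq')))
  obtain ⟨μ, hμ⟩ := h
  refine ⟨fun p => (μ p : ZMod n), ?_⟩
  have h2 := congrArg (Int.cast : ℤ → ZMod n) hμ
  rw [Int.cast_sum, Int.cast_one] at h2
  rw [← h2]
  refine Finset.sum_congr rfl fun p hp => ?_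
  have : ∏ j ∈ n.primeFactors \ {p}, j ^ n.factorization j = n / p ^ n.factorization p := by
    have hprod : ∏ j ∈ n.primeFactors, j ^ n.factorization j = n :=
      Nat.prod_factorization_pow_eq_self (by omega)
    symm
    apply Nat.div_eq_of_eq_mul_left
    · exact pow_pos (Nat.prime_of_mem_primeFactors hp).pos _
    · rw [Finset.sdiff_singleton_eq_erase, Finset.prod_erase_mul _ _ hp, hprod]
  rw [← this]
  push_cast
  rfl

lemma sum_ind {n p : ℕ} [NeZero n] (hp : p.Prime) (hpn : p ∣ n) (x : ZMod n) :
    ∑ k ∈ Finset.range p, (if p ∣ (x - (k : ZMod n)).val then (1 : ZMod n) else 0) = 1 := by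
  rw [Finset.sum_eq_single (x.val % p)]
  · rw [if_pos]
    rw [dvd_val_iff' hpn]
    refine ⟨((x.val / p : ℕ) : ZMod n), ?_⟩
    have := congrArg (Nat.cast : ℕ → ZMod n) (Nat.mod_add_div x.val p)
    push_cast [ZMod.natCast_zmod_val] at this
    push_cast
    linear_combination -this
  · intro k hk hne
    rw [if_neg]
    rw [dvd_val_iff' hpn]
    intro hd
    apply hne
    have := map_dvd (ZMod.castHom hpn (ZMod p)) hd
    rw [map_natCast, ZMod.natCast_self, zero_dvd_iff, map_sub, map_natCast, sub_eq_zero,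
      ← ZMod.natCast_zmod_val x, map_natCast, ZMod.natCast_eq_natCast_iff] at this
    rw [this, Nat.mod_eq_of_lt (Finset.mem_range.1 hk)]
  · intro h
    exact absurd (Finset.mem_range.2 (Nat.mod_lt _ hp.pos)) h

theorem polyFun_iff_mem_span_upj_shifts (n : ℕ) (hn : 2 ≤ n)
    (f : ZMod n → ZMod n) :
    IsPolyFun n f ↔ f ∈ Submodule.span (ZMod n)
      {g : ZMod n → ZMod n | ∃ p j k : ℕ, p.Prime ∧ p ∣ n ∧
        j < n.factorization p ∧ k < p ∧
        g = fun a => upj n p j (a - (k : ZMod n))} := by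
  haveI : NeZero n := ⟨by omega⟩
  constructor
  · rintro ⟨g, hg⟩
    set S := Submodule.span (ZMod n)
      {g : ZMod n → ZMod n | ∃ p j k : ℕ, p.Prime ∧ p ∣ n ∧
        j < n.factorization p ∧ k < p ∧
        g = fun a => upj n p j (a - (k : ZMod n))} with hS
    -- all shifts, any exponent
    have h1 : ∀ p ∈ n.primeFactors, ∀ k < p, ∀ j,
        (fun a => upj n p j (a - (k : ZMod n))) ∈ S := by
      intro p hp k hk j
      have hpn := Nat.dvd_of_mem_primeFactors hp
      by_cases hj : j < n.factorization p
      · exact Submodule.subset_span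
          ⟨p, j, k, Nat.prime_of_mem_primeFactors hp, hpn, hj, hk, rfl⟩
      · convert S.zero_mem using 1
        funext a
        unfold upj
        split_ifs with h
        · exact N_mul_pow (not_lt.1 hj) ((dvd_val_iff' hpn _).1 h)
        · rfl
    have h2 : ∀ m : ℕ, (fun a : ZMod n => a ^ m) ∈ S := by
      intro m
      obtain ⟨c, hc⟩ := exists_sum_N n hn
      have key : (fun a : ZMod n => a ^ m) = ∑ p ∈ n.primeFactors, c p •
          ∑ k ∈ Finset.range p, ∑ i ∈ Finset.range (m + 1),
            (((k : ZMod n) ^ (m - i) * (m.choose i : ZMod n)) •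
              fun a => upj n p i (a - (k : ZMod n))) := by
        funext a
        simp only [Finset.sum_apply, Pi.smul_apply, smul_eq_mul]
        rw [← one_mul (a ^ m), ← hc, Finset.sum_mul]
        refine Finset.sum_congr rfl fun p hp => ?_
        rw [mul_assoc]
        congr 1
        rw [← one_mul (_ * a ^ m), ← sum_ind (Nat.prime_of_mem_primeFactors hp)
          (Nat.dvd_of_mem_primeFactors hp) a, Finset.sum_mul]
        refine Finset.sum_congr rfl fun k _ => ?_
        unfold upj
        split_ifs with h
        · have := add_pow (a - (k : ZMod n)) (k : ZMod n) m
          rw [sub_add_cancel] at this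
          rw [this, one_mul, Finset.mul_sum]
          refine Finset.sum_congr rfl fun i _ => ?_
          ring
        · simp
      rw [key]
      refine S.sum_mem fun p hp => S.smul_mem _ (S.sum_mem fun k hk => S.sum_mem fun i _ =>
        S.smul_mem _ (h1 p hp k (Finset.mem_range.1 hk) i))
    have h3 : f = ∑ i ∈ Finset.range (g.natDegree + 1), g.coeff i • fun a : ZMod n => a ^ i := by
      funext a
      rw [← hg a, Polynomial.eval_eq_sum_range]
      simp [Finset.sum_apply]
    rw [h3]
    exact S.sum_mem fun i _ => S.smul_mem _ (h2 i)
  · intro hf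
    induction hf using Submodule.span_induction with
    | mem x hx =>
      obtain ⟨p, j, k, hp, hpn, -, -, rfl⟩ := hx
      refine ⟨(Polynomial.C ((n / p ^ n.factorization p : ℕ) : ZMod n) *
        ((1 - Polynomial.X ^ ((p ^ n.factorization p).totient * n.factorization p)) *
          Polynomial.X ^ j)).comp (Polynomial.X - Polynomial.C (k : ZMod n)), fun a => ?_⟩
      beta_reduce
      rw [upj_eq hp hpn]
      simp only [Polynomial.eval_comp, Polynomial.eval_mul, Polynomial.eval_sub,
        Polynomial.eval_pow, Polynomial.eval_X, Polynomial.eval_C, Polynomial.eval_one]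
    | zero => exact ⟨0, fun a => by simp⟩
    | add x y _ _ hx hy =>
      obtain ⟨g, hg⟩ := hx
      obtain ⟨h, hh⟩ := hy
      exact ⟨g + h, fun a => by simp [hg, hh]⟩
    | smul c x _ hx =>
      obtain ⟨g, hg⟩ := hx
      exact ⟨Polynomial.C c * g, fun a => by simp [hg]⟩
end

section
/- Let n ≥ 2 be an integer, let p be a prime dividing n with e the exponent of p in n, let j ∈ ℕ, and let k ∈ ℕ be a multiple of p. Then the shifted function u_{p,j}^{<k>} belongs to the ℤ/nℤ-submodule spanned by the unshifted functions { u_{p,ℓ} : 0 ≤ ℓ ≤ j }. -/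
theorem upj_shift_multiple_mem_span (n : ℕ) (hn : 2 ≤ n) (p : ℕ) (hp : p.Prime)
    (hpn : p ∣ n) (j k : ℕ) (hk : p ∣ k) :
    (fun a : ZMod n => upj n p j (a - (k : ZMod n))) ∈ Submodule.span (ZMod n)
      {f : ZMod n → ZMod n | ∃ ℓ ≤ j, f = upj n p ℓ} := by
  haveI : NeZero n := ⟨by omega⟩
  have key : ∀ a : ZMod n, p ∣ a.val ↔ ZMod.castHom hpn (ZMod p) a = 0 := by
    intro a
    rw [← ZMod.natCast_eq_zero_iff]
    conv_rhs => rw [← ZMod.natCast_zmod_val a]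
    rw [map_natCast]
  have hk0 : ((k : ℕ) : ZMod p) = 0 := (ZMod.natCast_eq_zero_iff k p).2 hk
  have key2 : ∀ a : ZMod n, p ∣ (a - (k : ZMod n)).val ↔ p ∣ a.val := by
    intro a
    rw [key, key, map_sub, map_natCast, hk0, sub_zero]
  have h : (fun a : ZMod n => upj n p j (a - (k : ZMod n))) =
      ∑ m ∈ Finset.range (j + 1),
        ((-(k : ZMod n)) ^ (j - m) * (j.choose m : ZMod n)) • upj n p m := by
    funext a
    rw [Finset.sum_apply]
    simp only [Pi.smul_apply, smul_eq_mul, upj, key2]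
    by_cases ha : p ∣ a.val
    · simp only [ha, if_true]
      rw [sub_eq_add_neg, add_pow, Finset.mul_sum]
      refine Finset.sum_congr rfl fun m _ => ?_
      ring
    · simp [ha]
  rw [h]
  refine Submodule.sum_mem _ fun m hm => Submodule.smul_mem _ _ (Submodule.subset_span ?_)
  exact ⟨m, by have := Finset.mem_range.1 hm; omega, rfl⟩
end
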